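/- arXiv:2308.12651 — 3 statements merged into one kernel-verified Lean document; each statement's English description precedes it below -/
import Mathlib

section
/- Let W be a walk in ℤ² from (i′,j′) to (1,0). Let r₁ and l₁ denote the numbers of rightward and leftward steps of W lying in the R-region, and r₂ and l₂ the numbers of rightward and leftward steps of W lying in the L-region. Then l₁ − l₂ + r₁ + r₂ = 2r₁ + |i′ − 1|. In particular, if i′ ≤ 1 then l₁ = r₁ and l₂ = r₂ − (1 − i′), while if i′ > 1 then l₁ = r₁ + (i′ − 1) and l₂ = r₂. -/
/-- `v 0, v 1, …, v m` is a walk in `ℤ²`: consecutive points are at ℓ¹-distance 1. -/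
def IsGridWalk (v : ℕ → ℤ × ℤ) (m : ℕ) : Prop :=
  ∀ k < m, |(v (k + 1)).1 - (v k).1| + |(v (k + 1)).2 - (v k).2| = 1

/-- Number of rightward steps of the walk lying in the R-region (the traversed
edge is between columns `x` and `x+1` with `x ≥ 1`). -/
def rStepsR (v : ℕ → ℤ × ℤ) (m : ℕ) : ℕ :=
  ((Finset.range m).filter fun k => (v (k + 1)).1 = (v k).1 + 1 ∧ 1 ≤ (v k).1).card

/-- Number of leftward steps of the walk lying in the R-region. -/
def lStepsR (v : ℕ → ℤ × ℤ) (m : ℕ) : ℕ :=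
  ((Finset.range m).filter fun k => (v (k + 1)).1 = (v k).1 - 1 ∧ 1 ≤ (v (k + 1)).1).card

/-- Number of rightward steps of the walk lying in the L-region (the traversed
edge is between columns `x` and `x+1` with `x ≤ 0`). -/
def rStepsL (v : ℕ → ℤ × ℤ) (m : ℕ) : ℕ :=
  ((Finset.range m).filter fun k => (v (k + 1)).1 = (v k).1 + 1 ∧ (v k).1 ≤ 0).card

/-- Number of leftward steps of the walk lying in the L-region. -/
def lStepsL (v : ℕ → ℤ × ℤ) (m : ℕ) : ℕ :=
  ((Finset.range m).filter fun k => (v (k + 1)).1 = (v k).1 - 1 ∧ (v (k + 1)).1 ≤ 0).card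

/-- Number of upward steps of the walk lying in the U-region (the traversed
edge is between rows `y` and `y+1` with `y ≥ 0`). -/
def uStepsU (v : ℕ → ℤ × ℤ) (m : ℕ) : ℕ :=
  ((Finset.range m).filter fun k => (v (k + 1)).2 = (v k).2 + 1 ∧ 0 ≤ (v k).2).card

/-- Number of downward steps of the walk lying in the U-region. -/
def dStepsU (v : ℕ → ℤ × ℤ) (m : ℕ) : ℕ :=
  ((Finset.range m).filter fun k => (v (k + 1)).2 = (v k).2 - 1 ∧ 0 ≤ (v (k + 1)).2).card

/-- Number of upward steps of the walk lying in the D-region (the traversed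
edge is between rows `y` and `y+1` with `y ≤ −1`). -/
def uStepsD (v : ℕ → ℤ × ℤ) (m : ℕ) : ℕ :=
  ((Finset.range m).filter fun k => (v (k + 1)).2 = (v k).2 + 1 ∧ (v k).2 ≤ -1).card

/-- Number of downward steps of the walk lying in the D-region. -/
def dStepsD (v : ℕ → ℤ × ℤ) (m : ℕ) : ℕ :=
  ((Finset.range m).filter fun k => (v (k + 1)).2 = (v k).2 - 1 ∧ (v (k + 1)).2 ≤ -1).card

theorem steps_invariant (v : ℕ → ℤ × ℤ) (m : ℕ) (hwalk : IsGridWalk v m) :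
    (rStepsR v m : ℤ) - lStepsR v m = max (v m).1 1 - max (v 0).1 1 ∧
    (rStepsL v m : ℤ) - lStepsL v m = min (v m).1 1 - min (v 0).1 1 := by
  induction m with
  | zero => simp [rStepsR, lStepsR, rStepsL, lStepsL]
  | succ n ih =>
    obtain ⟨h1, h2⟩ := ih (fun k hk => hwalk k (by omega))
    have hs := hwalk n (by omega)
    have hx : (v (n + 1)).1 = (v n).1 + 1 ∨ (v (n + 1)).1 = (v n).1 - 1 ∨
        (v (n + 1)).1 = (v n).1 := by
      have := abs_nonneg ((v (n + 1)).2 - (v n).2)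
      have h3 : |(v (n + 1)).1 - (v n).1| ≤ 1 := by omega
      have := abs_le.mp h3
      omega
    simp only [rStepsR, lStepsR, rStepsL, lStepsL, Finset.card_filter,
      Finset.sum_range_succ] at h1 h2 ⊢
    push_cast at h1 h2 ⊢
    constructor
    · split_ifs <;> omega
    · split_ifs <;> omega

/-- For a walk from `(i′,j′)` to `(1,0)` in `ℤ²`, with `r₁, l₁` the numbers of
rightward/leftward steps in the R-region and `r₂, l₂` those in the L-region:
`l₁ − l₂ + r₁ + r₂ = 2r₁ + |i′ − 1|`; in particular if `i′ ≤ 1` then `l₁ = r₁` and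
`l₂ = r₂ − (1 − i′)`, and if `i′ > 1` then `l₁ = r₁ + (i′ − 1)` and `l₂ = r₂`. -/
theorem stmt6 (v : ℕ → ℤ × ℤ) (m : ℕ) (i' j' : ℤ)
    (hwalk : IsGridWalk v m) (h0 : v 0 = (i', j')) (hm : v m = (1, 0)) :
    (lStepsR v m : ℤ) - lStepsL v m + rStepsR v m + rStepsL v m
      = 2 * rStepsR v m + |i' - 1| ∧
    (i' ≤ 1 → lStepsR v m = rStepsR v m ∧ (lStepsL v m : ℤ) = rStepsL v m - (1 - i')) ∧
    (1 < i' → (lStepsR v m : ℤ) = rStepsR v m + (i' - 1) ∧ lStepsL v m = rStepsL v m) := by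
  obtain ⟨h1, h2⟩ := steps_invariant v m hwalk
  rw [h0, hm] at h1 h2
  simp only at h1 h2
  refine ⟨?_, ?_, ?_⟩
  · rcases abs_cases (i' - 1) with ⟨h, _⟩ | ⟨h, _⟩ <;> rw [h] <;> omega
  · intro h
    constructor <;> omega
  · intro h
    constructor <;> omega
end

section
/- For every walk W of length m in ℤ² from (i′,j′) to (1,0), one has m − 2·l₂ − 2·u₁ ≥ |i′ − 1| + |j′|, where l₂ is the number of leftward steps of W lying in the L-region and u₁ is the number of upward steps of W lying in the U-region. (This is the key inequality in the proof of the paper's Lemma 1: in the residual network only leftward edges in the L-region and upward edges in the U-region can be reverse edges of cost −τ, so the cost of any residual path from (i′,j′) to q = (1,0) is at least (m − 2l₂ − 2u₁)·τ ≥ (|i′−1| + |j′|)·τ.) -/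
theorem stmt8_aux (v : ℕ → ℤ × ℤ) (m : ℕ) (hwalk : IsGridWalk v m) :
    |(v 0).1 - 1| + |(v 0).2| ≤
      (m : ℤ) - 2 * lStepsL v m - 2 * uStepsU v m + (|(v m).1 - 1| + |(v m).2|) := by
  induction m with
  | zero => simp [lStepsL, uStepsU]
  | succ n ih =>
    have ih := ih (fun k hk => hwalk k (by omega))
    have hs := hwalk n (by omega)
    have hl : lStepsL v (n + 1) = lStepsL v n +
        (if (v (n + 1)).1 = (v n).1 - 1 ∧ (v (n + 1)).1 ≤ 0 then 1 else 0) := by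
      unfold lStepsL
      rw [Finset.range_add_one, Finset.filter_insert]
      split_ifs <;> simp
    have hu : uStepsU v (n + 1) = uStepsU v n +
        (if (v (n + 1)).2 = (v n).2 + 1 ∧ 0 ≤ (v n).2 then 1 else 0) := by
      unfold uStepsU
      rw [Finset.range_add_one, Finset.filter_insert]
      split_ifs <;> simp
    rw [hl, hu]
    generalize lStepsL v n = a at *
    generalize uStepsU v n = b at *
    generalize |(v 0).1 - 1| + |(v 0).2| = c at *
    generalize (v (n + 1)).1 = x' at *
    generalize (v (n + 1)).2 = y' at *
    generalize (v n).1 = x at *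
    generalize (v n).2 = y at *
    clear hl hu hwalk
    push_cast
    simp only [abs_eq_max_neg] at *
    split_ifs <;> omega

/-- For every walk of length `m` in `ℤ²` from `(i′,j′)` to `(1,0)`,
`m − 2·l₂ − 2·u₁ ≥ |i′ − 1| + |j′|`, where `l₂` counts leftward steps in the
L-region and `u₁` counts upward steps in the U-region. -/
theorem stmt8 (v : ℕ → ℤ × ℤ) (m : ℕ) (i' j' : ℤ)
    (hwalk : IsGridWalk v m) (h0 : v 0 = (i', j')) (hm : v m = (1, 0)) :
    |i' - 1| + |j'| ≤ (m : ℤ) - 2 * lStepsL v m - 2 * uStepsU v m := by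
  have h := stmt8_aux v m hwalk
  rw [h0, hm] at h
  simpa using h
end

section
/- The quantity Θ = inf{θ ≥ 0 : o(θ) ≥ w} satisfies Θ = min{ y + w/c + dp, −y + τ + w/c + dq, w/(2c) + (dp + dq + τ)/2 }, and this infimum is attained (i.e., o(Θ) ≥ w). In particular, regarded as a function of y on the open interval (0,τ), Θ is a piecewise linear function consisting of at most three line segments. -/
/-- With `o(θ) = max{0, c(θ−dp−y), c(θ−dq−τ+y), c(2θ−dp−dq−τ)}`, the quantity
`Θ = inf{θ ≥ 0 : o(θ) ≥ w}` equals
`min{ y + w/c + dp, −y + τ + w/c + dq, w/(2c) + (dp+dq+τ)/2 }`, and the infimum is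
attained, i.e. `o(Θ) ≥ w`. Each of the three expressions is linear in `y`, so
`Θ(X,·)` is piecewise linear on `(0,τ)` with at most three segments. -/
theorem stmt9 (c τ y dp dq w : ℝ) (hc : 0 < c) (hτ : 0 < τ)
    (hy0 : 0 < y) (hyτ : y < τ) (hdp : 0 ≤ dp) (hdq : 0 ≤ dq) (hw : 0 < w)
    (o : ℝ → ℝ)
    (ho : ∀ θ : ℝ, o θ = max (max 0 (c * (θ - dp - y)))
      (max (c * (θ - dq - τ + y)) (c * (2 * θ - dp - dq - τ))))
    (Θ : ℝ) (hΘ : Θ = sInf {θ : ℝ | 0 ≤ θ ∧ w ≤ o θ}) :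
    Θ = min (y + w / c + dp)
      (min (-y + τ + w / c + dq) (w / (2 * c) + (dp + dq + τ) / 2)) ∧
    w ≤ o Θ := by
  have key : ∀ a θ : ℝ, w ≤ c * (θ - a) ↔ a + w / c ≤ θ := by
    intro a θ
    rw [mul_comm, ← div_le_iff₀ hc]
    constructor <;> intro h <;> linarith
  have hhalf : w / (2 * c) = w / c / 2 := by
    field_simp
  have hwc : 0 < w / c := div_pos hw hc
  have hiff : ∀ θ : ℝ, w ≤ o θ ↔ min (y + w / c + dp)
      (min (-y + τ + w / c + dq) (w / (2 * c) + (dp + dq + τ) / 2)) ≤ θ := by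
    intro θ
    have h1 := key (dp + y) θ
    have h2 := key (dq + τ - y) θ
    have h3 := key (dp + dq + τ) (2 * θ)
    rw [show θ - (dp + y) = θ - dp - y by ring] at h1
    rw [show θ - (dq + τ - y) = θ - dq - τ + y by ring] at h2
    rw [show 2 * θ - (dp + dq + τ) = 2 * θ - dp - dq - τ by ring] at h3
    rw [ho, le_max_iff, le_max_iff, le_max_iff, min_le_iff, min_le_iff, h1, h2, h3, hhalf]
    constructor
    · rintro ((h | h) | h | h)
      · linarith
      · left; linarith
      · right; left; linarith
      · right; right; linarith
    · rintro (h | h | h)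
      · left; right; linarith
      · right; left; linarith
      · right; right; linarith
  have hM : 0 ≤ min (y + w / c + dp)
      (min (-y + τ + w / c + dq) (w / (2 * c) + (dp + dq + τ) / 2)) := by
    rw [hhalf]
    refine le_min ?_ (le_min ?_ ?_) <;> linarith
  have hset : {θ : ℝ | 0 ≤ θ ∧ w ≤ o θ} = Set.Ici (min (y + w / c + dp)
      (min (-y + τ + w / c + dq) (w / (2 * c) + (dp + dq + τ) / 2))) := by
    ext θ
    simp only [Set.mem_setOf_eq, Set.mem_Ici]
    rw [hiff]
    exact ⟨fun h => h.2, fun h => ⟨hM.trans h, h⟩⟩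
  rw [hset, csInf_Ici] at hΘ
  exact ⟨hΘ, (hiff Θ).2 hΘ.ge⟩
end
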